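/- Let 0 < α < 1. For any real number λ > 1/(2πα) there exists a constant C_λ such that for every real-valued function φ on ℝ² that is α-Hölder continuous, supported in the closed unit ball {|x| ≤ 1}, not identically zero, and has ∇φ ∈ L²(ℝ²), one has ‖φ‖²_{L^∞} ≤ λ ‖∇φ‖²_{L²} · log( C_λ + [φ]_{α} / ‖∇φ‖_{L²} ), where [φ]_α := sup_{x≠y} |φ(x)−φ(y)|/|x−y|^α is the homogeneous Hölder seminorm. -/

import Mathlib

open MeasureTheory Real Classical
open scoped ENNReal RealInnerProductSpace

noncomputable section

/-- The plane `ℝ²`. -/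
abbrev Plane := EuclideanSpace ℝ (Fin 2)

/-- Pointwise norm of the (full) gradient of `u`. -/
def gradNorm (u : Plane → ℝ) (x : Plane) : ℝ := ‖fderiv ℝ u x‖

/-- The `L^p` norm for a real (finite) exponent `p`. -/
def LpNorm (p : ℝ) (u : Plane → ℝ) : ℝ := (∫ x : Plane, |u x| ^ p) ^ (1 / p)

/-- The sup (`L^∞`) norm. -/
def supNorm (u : Plane → ℝ) : ℝ := ⨆ x : Plane, |u x|

/-- The homogeneous Hölder seminorm `[u]_α`. -/
def holderSemi (α : ℝ) (u : Plane → ℝ) : ℝ :=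
  ⨆ p : Plane × Plane,
    if p.1 = p.2 then 0 else |u p.1 - u p.2| / ‖p.1 - p.2‖ ^ α

/-- The Hölder norm `‖u‖_{C^α} = sup |u| + [u]_α`. -/
def holderNorm (α : ℝ) (u : Plane → ℝ) : ℝ := supNorm u + holderSemi α u

/-- `u` is `α`-Hölder continuous. -/
def IsHolder (α : ℝ) (u : Plane → ℝ) : Prop :=
  ∃ C : ℝ, 0 ≤ C ∧ ∀ x y : Plane, |u x - u y| ≤ C * ‖x - y‖ ^ α

/-- The squared `H¹` norm `‖∇u‖_{L²}² + ‖u‖_{L²}²`. -/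
def H1Sq (u : Plane → ℝ) : ℝ :=
  (∫ x : Plane, gradNorm u x ^ 2) + ∫ x : Plane, u x ^ 2

/-- The squared local `H¹` norm `‖u‖_{H¹[R]}²`. -/
def H1locSq (R : ℝ) (u : Plane → ℝ) : ℝ :=
  ⨆ c : Plane, ∫ x in Metric.closedBall c R, (gradNorm u x ^ 2 + u x ^ 2)

/-- Membership in `H¹(ℝ²)` (with classical derivatives). -/
def MemH1 (u : Plane → ℝ) : Prop :=
  Differentiable ℝ u ∧ Integrable (fun x => u x ^ 2) ∧
    Integrable (fun x => gradNorm u x ^ 2)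

/-- The nonlinearity `f(u) = (e^{4π u²} - 1 - 4π u²) u`. -/
def f (s : ℝ) : ℝ := (Real.exp (4 * π * s ^ 2) - 1 - 4 * π * s ^ 2) * s

/-- The potential `F(u) = (1/8π)(e^{4π u²} - 1 - 4π u² - 8π² u⁴)`. -/
def F (s : ℝ) : ℝ :=
  (8 * π)⁻¹ * (Real.exp (4 * π * s ^ 2) - 1 - 4 * π * s ^ 2 - 8 * π ^ 2 * s ^ 4)

open Set in
/-- Integration in polar coordinates on the plane, for nonnegative functions. -/
lemma lintegral_plane_polar {h : Plane → ℝ≥0∞} (hh : Measurable h) :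
    ∫⁻ x : Plane, h x =
      ∫⁻ ω : Metric.sphere (0 : Plane) 1, (∫⁻ r in Ioi (0 : ℝ), ENNReal.ofReal r * h (r • ω.1))
        ∂(volume : Measure Plane).toSphere := by
  have hmp := (volume : Measure Plane).measurePreserving_homeomorphUnitSphereProd
  have hdim : Module.finrank ℝ Plane - 1 = 1 := by simp
  have hcomp : Measurable fun p : Metric.sphere (0 : Plane) 1 × Ioi (0 : ℝ) =>
      h (p.2.1 • p.1.1) := by fun_prop
  calc ∫⁻ x : Plane, h x = ∫⁻ x in ({0}ᶜ : Set Plane), h x := by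
        rw [restrict_compl_singleton]
    _ = ∫⁻ x : ({0}ᶜ : Set Plane), h x ∂(volume.comap Subtype.val) :=
        (lintegral_subtype_comap (measurableSet_singleton _).compl _).symm
    _ = ∫⁻ x : ({0}ᶜ : Set Plane), (fun p : Metric.sphere (0 : Plane) 1 × Ioi (0 : ℝ) =>
          h (p.2.1 • p.1.1)) (homeomorphUnitSphereProd Plane x) ∂(volume.comap Subtype.val) := by
        refine lintegral_congr fun x => ?_
        have hx : ‖x.1‖ ≠ 0 := norm_ne_zero_iff.2 x.2
        simp [smul_smul, hx]
    _ = ∫⁻ p, h (p.2.1 • p.1.1)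
          ∂((volume : Measure Plane).toSphere.prod (Measure.volumeIoiPow 1)) := by
        rw [hmp.lintegral_comp hcomp, hdim]
    _ = _ := by
        rw [lintegral_prod _ hcomp.aemeasurable]
        refine lintegral_congr fun ω => ?_
        rw [Measure.volumeIoiPow, lintegral_withDensity_eq_lintegral_mul _ (by fun_prop)
          (by fun_prop)]
        simp only [Pi.mul_apply, pow_one]
        exact lintegral_subtype_comap measurableSet_Ioi
          fun r : ℝ => ENNReal.ofReal r * h (r • ω.1)

lemma toSphere_plane_univ :
    (volume : Measure Plane).toSphere Set.univ = ENNReal.ofReal (2 * π) := by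
  rw [Measure.toSphere_apply_univ, EuclideanSpace.volume_ball_fin_two,
    ENNReal.ofReal_mul zero_le_two]
  simp

open Set in
/-- Some ray issuing from `c` carries at most the average share of the integral of `g`. -/
lemma exists_ray_integral_le {g : Plane → ℝ} (hgm : Measurable g) (hg0 : ∀ x, 0 ≤ g x)
    (hgi : Integrable g) (c : Plane) :
    ∃ ω : Plane, ‖ω‖ = 1 ∧ IntegrableOn (fun r : ℝ => r * g (c + r • ω)) (Ioi 0) ∧
      ∫ r in Ioi (0 : ℝ), r * g (c + r • ω) ≤ (∫ x, g x) / (2 * π) := by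
  have hm : Measurable fun x : Plane => ENNReal.ofReal (g (c + x)) := by fun_prop
  obtain ⟨ω, hω⟩ := exists_le_laverage (μ := (volume : Measure Plane).toSphere)
    (Measure.toSphere_ne_zero _)
    (f := fun ω => ∫⁻ r in Ioi (0 : ℝ), ENNReal.ofReal r * ENNReal.ofReal (g (c + r • ω.1)))
    (Measurable.aemeasurable (Measurable.lintegral_prod_right' (f := fun p :
      Metric.sphere (0 : Plane) 1 × ℝ =>
        ENNReal.ofReal p.2 * ENNReal.ofReal (g (c + p.2 • p.1.1))) (by fun_prop)))
  have htot : ∫⁻ x : Plane, ENNReal.ofReal (g (c + x)) = ENNReal.ofReal (∫ x, g x) := by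
    rw [lintegral_add_left_eq_self (fun x => ENNReal.ofReal (g x)) c,
      ofReal_integral_eq_lintegral_ofReal hgi (.of_forall hg0)]
  rw [laverage_eq, ← lintegral_plane_polar hm, htot, toSphere_plane_univ,
    ← ENNReal.ofReal_div_of_pos (by positivity)] at hω
  have hcongr : ∫⁻ r in Ioi (0 : ℝ), ENNReal.ofReal r * ENNReal.ofReal (g (c + r • ω.1)) =
      ∫⁻ r in Ioi (0 : ℝ), ENNReal.ofReal (r * g (c + r • ω.1)) :=
    setLIntegral_congr_fun measurableSet_Ioi fun r (hr : 0 < r) =>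
      (ENNReal.ofReal_mul hr.le).symm
  rw [hcongr] at hω
  have hnn : 0 ≤ᵐ[volume.restrict (Ioi (0 : ℝ))] fun r : ℝ => r * g (c + r • ω.1) :=
    (ae_restrict_iff' measurableSet_Ioi).2
      (.of_forall fun r (hr : 0 < r) => mul_nonneg hr.le (hg0 _))
  have hsm : Measurable fun r : ℝ => r * g (c + r • ω.1) := by fun_prop
  refine ⟨ω.1, by simp, ⟨hsm.aestronglyMeasurable, ?_⟩, ?_⟩
  · rw [hasFiniteIntegral_iff_ofReal hnn]
    exact hω.trans_lt ENNReal.ofReal_lt_top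
  · rw [integral_eq_lintegral_of_nonneg_ae hnn hsm.aestronglyMeasurable]
    exact ENNReal.toReal_le_of_le_ofReal
      (div_nonneg (integral_nonneg hg0) (by positivity)) hω

lemma measurable_gradNorm (u : Plane → ℝ) : Measurable (gradNorm u) :=
  (measurable_fderiv ℝ u).norm

/-- A point value on a ray is bounded by the weighted Dirichlet energy along the ray. -/
lemma abs_sub_le_ray_energy {φ : Plane → ℝ} (hφ : Differentiable ℝ φ) (c ω : Plane)
    (hω : ‖ω‖ = 1)
    (hi : IntegrableOn (fun r : ℝ => r * gradNorm φ (c + r • ω) ^ 2) (Set.Ioi 0))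
    {r R t : ℝ} (hr : 0 < r) (hrR : r ≤ R) (ht : 0 < t) :
    |φ (c + R • ω) - φ (c + r • ω)| ≤
      (t * (∫ s in Set.Ioi (0 : ℝ), s * gradNorm φ (c + s • ω) ^ 2) + Real.log (R / r) / t) / 2 := by
  have hR : 0 < R := hr.trans_le hrR
  set k : ℝ → ℝ := fun s => s * gradNorm φ (c + s • ω) ^ 2 with hk
  have hsub : Set.Ioc r R ⊆ Set.Ioi 0 := fun s hs => hr.trans hs.1
  have hki : IntervalIntegrable k volume r R :=
    (intervalIntegrable_iff_integrableOn_Ioc_of_le hrR).2 (hi.mono_set hsub)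
  have hinv : IntervalIntegrable (fun s : ℝ => s⁻¹) volume r R :=
    intervalIntegral.intervalIntegrable_inv (fun s hs => by
      rw [Set.uIcc_of_le hrR] at hs
      exact (hr.trans_le hs.1).ne') continuousOn_id
  have hB : IntervalIntegrable (fun s => (t * k s + s⁻¹ / t) / 2) volume r R :=
    ((hki.const_mul t).add (hinv.div_const t)).div_const 2
  have hd : ∀ s : ℝ, HasDerivAt (fun s : ℝ => φ (c + s • ω)) (fderiv ℝ φ (c + s • ω) ω) s := by
    intro s
    have h1 : HasDerivAt (fun s : ℝ => c + s • ω) ω s := by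
      simpa using ((hasDerivAt_id s).smul_const ω).const_add c
    exact (hφ _).hasFDerivAt.comp_hasDerivAt s h1
  have hbound : ∀ s ∈ Set.Ioc r R,
      ‖fderiv ℝ φ (c + s • ω) ω‖ ≤ (t * k s + s⁻¹ / t) / 2 := by
    intro s hs
    have hs0 : 0 < s := hsub hs
    have h1 : ‖fderiv ℝ φ (c + s • ω) ω‖ ≤ gradNorm φ (c + s • ω) := by
      simpa [hω, gradNorm] using (fderiv ℝ φ (c + s • ω)).le_opNorm ω
    refine h1.trans ?_
    set y := gradNorm φ (c + s • ω)
    have h2 : (t * (s * y ^ 2) + s⁻¹ / t) / 2 - y = (t * s * y - 1) ^ 2 / (2 * t * s) := by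
      field_simp
      ring
    have h3 : 0 ≤ (t * s * y - 1) ^ 2 / (2 * t * s) := by positivity
    simp only [hk]
    linarith
  have hm : Measurable fun s : ℝ => fderiv ℝ φ (c + s • ω) ω :=
    (measurable_fderiv_apply_const ℝ φ ω).comp (by fun_prop)
  have hdi : IntervalIntegrable (fun s : ℝ => fderiv ℝ φ (c + s • ω) ω) volume r R := by
    refine hB.mono_fun' hm.aestronglyMeasurable ?_
    rw [Set.uIoc_of_le hrR]
    exact (ae_restrict_iff' measurableSet_Ioc).2 (.of_forall hbound)
  rw [← intervalIntegral.integral_eq_sub_of_hasDerivAt (fun s _ => hd s) hdi, ← Real.norm_eq_abs]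
  refine (intervalIntegral.norm_integral_le_of_norm_le hrR (.of_forall hbound) hB).trans ?_
  rw [intervalIntegral.integral_div, intervalIntegral.integral_add (hki.const_mul t)
    (hinv.div_const t), intervalIntegral.integral_const_mul, intervalIntegral.integral_div,
    integral_inv_of_pos hr hR]
  have hle : ∫ s in r..R, k s ≤ ∫ s in Set.Ioi (0 : ℝ), k s := by
    rw [intervalIntegral.integral_of_le hrR]
    refine setIntegral_mono_set hi ?_ hsub.eventuallyLE
    exact (ae_restrict_iff' measurableSet_Ioi).2
      (.of_forall fun s (hs : 0 < s) => mul_nonneg hs.le (sq_nonneg _))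
  gcongr

lemma holderSemi_nonneg (α : ℝ) (u : Plane → ℝ) : 0 ≤ holderSemi α u :=
  Real.iSup_nonneg fun p => by split_ifs <;> positivity

lemma IsHolder.abs_sub_le {α : ℝ} {u : Plane → ℝ} (hu : IsHolder α u) {x y : Plane}
    (hxy : x ≠ y) : |u x - u y| ≤ holderSemi α u * ‖x - y‖ ^ α := by
  obtain ⟨C, hC, h⟩ := hu
  have hpos : ∀ {x y : Plane}, x ≠ y → 0 < ‖x - y‖ ^ α := fun hne =>
    Real.rpow_pos_of_pos (norm_pos_iff.2 (sub_ne_zero.2 hne)) _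
  have hbdd : BddAbove (Set.range fun p : Plane × Plane =>
      if p.1 = p.2 then 0 else |u p.1 - u p.2| / ‖p.1 - p.2‖ ^ α) := by
    refine ⟨C, ?_⟩
    rintro _ ⟨p, rfl⟩
    dsimp only
    split_ifs with hp
    · exact hC
    · exact (div_le_iff₀ (hpos hp)).2 (h _ _)
  have := le_ciSup hbdd (x, y)
  simp only [if_neg hxy] at this
  exact (div_le_iff₀ (hpos hxy)).1 this

/-- Pointwise bound by the Dirichlet energy outside, and the Hölder seminorm inside, the disk of
radius `r`. -/
lemma abs_le_energy_add_holder {α : ℝ} {φ : Plane → ℝ} (hH : IsHolder α φ)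
    (hsupp : ∀ x : Plane, 1 < ‖x‖ → φ x = 0) (hφ : Differentiable ℝ φ)
    (hi : Integrable fun x => gradNorm φ x ^ 2) {c : Plane} (hc : ‖c‖ ≤ 1)
    {r t : ℝ} (hr : 0 < r) (hr3 : r ≤ 3) (ht : 0 < t) :
    |φ c| ≤ (t * ((∫ x, gradNorm φ x ^ 2) / (2 * π)) + Real.log (3 / r) / t) / 2 +
      holderSemi α φ * r ^ α := by
  obtain ⟨ω, hω, hωi, hle⟩ := exists_ray_integral_le ((measurable_gradNorm φ).pow_const 2)
    (fun x => sq_nonneg _) hi c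
  have hmain := abs_sub_le_ray_energy hφ c ω hω hωi hr hr3 ht
  have hfar : φ (c + (3 : ℝ) • ω) = 0 := by
    refine hsupp _ ?_
    have h1 : ‖(3 : ℝ) • ω‖ = 3 := by simp [norm_smul, hω]
    have h2 := norm_sub_le (c + (3 : ℝ) • ω) c
    rw [add_sub_cancel_left, h1] at h2
    linarith
  have hne : c ≠ c + r • ω := by
    have : r • ω ≠ 0 := smul_ne_zero hr.ne' (norm_ne_zero_iff.1 (by simp [hω]))
    simpa using this
  have hnear := hH.abs_sub_le hne
  have hdist : ‖c - (c + r • ω)‖ = r := by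
    simp [norm_smul, hω, abs_of_pos hr]
  rw [hdist] at hnear
  rw [hfar, zero_sub, abs_neg] at hmain
  have htri : |φ c| ≤ |φ c - φ (c + r • ω)| + |φ (c + r • ω)| := by
    simpa using abs_add_le (φ c - φ (c + r • ω)) (φ (c + r • ω))
  have hmul := mul_le_mul_of_nonneg_left hle ht.le
  linarith

/-- `√(aL + b) + 1 ≤ √(λL)` once `L` is large, when `a < λ`. -/
lemma sqrt_affine_add_one_le {a b l L : ℝ} (ha : 0 < a) (hal : a < l)
    (h1 : 1 ≤ l * L) (h2 : 2 / (l - a) * (b + 2 * l / (l - a)) ≤ L) :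
    √(a * L + b) + 1 ≤ √(l * L) := by
  have hδ : 0 < l - a := sub_pos.2 hal
  set δ := l - a with hδd
  have hl : 0 < l := ha.trans hal
  have hL : 0 < L := by
    by_contra hL
    nlinarith
  set s := √(l * L) with hs
  have hs2 : s ^ 2 = l * L := Real.sq_sqrt (by positivity)
  have hs1 : 1 ≤ s := Real.one_le_sqrt.2 h1
  have key : 2 * s ≤ δ * L / 2 + 2 * l / δ := by
    have h3 : δ * L / 2 + 2 * l / δ - 2 * s = (δ * s - 2 * l) ^ 2 / (2 * l * δ) := by
      have : L = s ^ 2 / l := by field_simp; linarith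
      rw [this]
      field_simp
      ring
    have h4 : 0 ≤ (δ * s - 2 * l) ^ 2 / (2 * l * δ) := by positivity
    linarith
  have h5 : b + 2 * l / δ ≤ δ * L / 2 := by
    have := mul_le_mul_of_nonneg_left h2 (by positivity : 0 ≤ δ / 2)
    calc b + 2 * l / δ = δ / 2 * (2 / δ * (b + 2 * l / δ)) := by field_simp
      _ ≤ _ := by linarith
  have h6 : √(a * L + b) ≤ s - 1 := by
    rw [Real.sqrt_le_left (by linarith)]
    have : δ * L = l * L - a * L := by rw [hδd]; ring
    nlinarith
  linarith

lemma dirichlet_energy_pos {α : ℝ} (hα : 0 < α) {φ : Plane → ℝ} (hH : IsHolder α φ)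
    (hsupp : ∀ x : Plane, 1 < ‖x‖ → φ x = 0) (hne : φ ≠ 0) (hφ : Differentiable ℝ φ)
    (hi : Integrable fun x => gradNorm φ x ^ 2) : 0 < ∫ x, gradNorm φ x ^ 2 := by
  refine (integral_nonneg fun x => sq_nonneg _).lt_of_ne' fun h0 => hne ?_
  funext c
  by_cases hc : 1 < ‖c‖
  · exact hsupp c hc
  have hlim : Filter.Tendsto (fun r : ℝ => r / 2 + holderSemi α φ * r ^ α) (nhdsWithin 0 (Set.Ioi 0))
      (nhds 0) := by
    have : Continuous fun r : ℝ => r / 2 + holderSemi α φ * r ^ α :=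
      (continuous_id.div_const 2).add (continuous_const.mul (continuous_id.rpow_const
        fun _ => Or.inr hα.le))
    simpa [Real.zero_rpow hα.ne'] using (this.tendsto 0).mono_left nhdsWithin_le_nhds
  have hle : |φ c| ≤ 0 := by
    refine ge_of_tendsto hlim ?_
    filter_upwards [Ioo_mem_nhdsGT (show (0 : ℝ) < 1 by norm_num)] with r hr
    have hlog : 0 < Real.log (3 / r) := Real.log_pos (by rw [lt_div_iff₀ hr.1]; linarith [hr.2])
    have := abs_le_energy_add_holder hH hsupp hφ hi (not_lt.1 hc) hr.1 (by linarith [hr.2])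
      (div_pos hlog hr.1)
    rw [h0] at this
    have hdiv : Real.log (3 / r) / (Real.log (3 / r) / r) = r := by
      have := hr.1
      field_simp
    simpa [hdiv] using this
  exact abs_nonpos_iff.1 hle

/-- logarithmic inequality on the unit disk. -/
theorem statement3 (α : ℝ) (hα : α ∈ Set.Ioo (0:ℝ) 1) (lam : ℝ)
    (hlam : 1 / (2 * π * α) < lam) :
    ∃ C : ℝ, 0 < C ∧ ∀ φ : Plane → ℝ,
      IsHolder α φ →
      (∀ x : Plane, 1 < ‖x‖ → φ x = 0) →
      φ ≠ 0 →
      Differentiable ℝ φ →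
      Integrable (fun x => gradNorm φ x ^ 2) →
      supNorm φ ^ 2 ≤
        lam * (∫ x : Plane, gradNorm φ x ^ 2) *
          Real.log (C + holderSemi α φ / Real.sqrt (∫ x : Plane, gradNorm φ x ^ 2)) := by
  have hα0 : 0 < α := hα.1
  set a : ℝ := 1 / (2 * π * α) with ha
  have ha0 : 0 < a := by positivity
  have hlam0 : 0 < lam := ha0.trans hlam
  set b : ℝ := Real.log 3 / (2 * π) with hb
  have hb0 : 0 < b := div_pos (Real.log_pos (by norm_num)) (by positivity)
  set K : ℝ := max (1 / lam) (2 / (lam - a) * (b + 2 * lam / (lam - a))) with hK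
  have hK0 : 0 < K := lt_max_of_lt_left (by positivity)
  refine ⟨Real.exp K, Real.exp_pos K, fun φ hH hsupp hne hφ hi => ?_⟩
  have hE := dirichlet_energy_pos hα0 hH hsupp hne hφ hi
  set E := ∫ x, gradNorm φ x ^ 2 with hEd
  set D := √E with hD
  have hD0 : 0 < D := Real.sqrt_pos.2 hE
  have hD2 : D ^ 2 = E := Real.sq_sqrt hE.le
  set H := holderSemi α φ with hHd
  have hH0 : 0 ≤ H := holderSemi_nonneg α φ
  set M := Real.exp K + H / D with hM
  have hMK : Real.exp K ≤ M := le_add_of_nonneg_right (by positivity)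
  have hM1 : 1 ≤ M := (Real.one_le_exp hK0.le).trans hMK
  have hM0 : 0 < M := one_pos.trans_le hM1
  set L := Real.log M with hL
  have hKL : K ≤ L := (Real.le_log_iff_exp_le hM0).2 hMK
  have hL0 : 0 < L := hK0.trans_le hKL
  have hnum : √(a * L + b) + 1 ≤ √(lam * L) := by
    refine sqrt_affine_add_one_le ha0 hlam ?_ ((le_max_right _ _).trans hKL)
    have := (le_max_left _ _).trans hKL
    rwa [div_le_iff₀' hlam0] at this
  set r : ℝ := M ^ (-(1 / α)) with hr
  have hr0 : 0 < r := Real.rpow_pos_of_pos hM0 _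
  have hr1 : r ≤ 1 := Real.rpow_le_one_of_one_le_of_nonpos hM1 (by
    have : 0 < 1 / α := by positivity
    linarith)
  have hrα : r ^ α = M⁻¹ := by
    rw [hr, ← Real.rpow_mul hM0.le, neg_mul, one_div_mul_cancel hα0.ne', Real.rpow_neg_one]
  have hHr : H * r ^ α ≤ D := by
    rw [hrα, mul_inv_le_iff₀ hM0, hM, mul_add, mul_div_cancel₀ _ hD0.ne']
    exact le_add_of_nonneg_left (by positivity)
  have hlog : Real.log (3 / r) = 2 * π * (a * L + b) := by
    rw [Real.log_div (by norm_num) hr0.ne', hr, Real.log_rpow hM0, ha, hb, hL]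
    field_simp
    ring
  set S := √(a * L + b) with hS
  have hS2 : S ^ 2 = a * L + b := Real.sq_sqrt (by positivity)
  have hS0 : 0 < S := Real.sqrt_pos.2 (by positivity)
  have hpt : ∀ x, |φ x| ≤ D * √(lam * L) := by
    intro x
    by_cases hx : 1 < ‖x‖
    · rw [hsupp x hx, abs_zero]
      positivity
    have h := abs_le_energy_add_holder hH hsupp hφ hi (not_lt.1 hx) hr0 (hr1.trans (by norm_num))
      (show 0 < 2 * π * S / D by positivity)
    rw [hlog, ← hEd, ← hHd, ← hD2, ← hS2] at h
    have hopt : (2 * π * S / D * (D ^ 2 / (2 * π)) + 2 * π * S ^ 2 / (2 * π * S / D)) / 2 =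
        D * S := by
      field_simp
      ring
    rw [hopt] at h
    nlinarith
  have hsup : supNorm φ ≤ D * √(lam * L) := ciSup_le hpt
  calc supNorm φ ^ 2 ≤ (D * √(lam * L)) ^ 2 :=
        pow_le_pow_left₀ (Real.iSup_nonneg fun x => abs_nonneg _) hsup 2
    _ = lam * E * L := by
        rw [mul_pow, hD2, Real.sq_sqrt (by positivity)]
        ring
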